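/- arXiv:1803.09307 — 3 statements merged into one kernel-verified Lean document; each statement's English description precedes it below -/
import Mathlib

section
/- Let d ≥ 2, let n, m ≥ 2 be integers with n dividing m, and let Γ ≤ SL_d(ℤ) be a subgroup with π_m(Γ) = G_m. Then a function f: G_n × G_m → {0,1} is invariant under the diagonal action γ·(x,y) := (π_n(γ)x, π_m(γ)y) of Γ if and only if f = f_Z for some subset Z ⊆ G_n. -/
/-- `G_n = SL_d(ℤ/nℤ)`. -/
abbrev SLmod (d n : ℕ) := Matrix.SpecialLinearGroup (Fin d) (ZMod n)

/-- Reduction modulo `n`, as a homomorphism `SL_d(ℤ) → SL_d(ℤ/nℤ)`. -/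
def redZ (d n : ℕ) : Matrix.SpecialLinearGroup (Fin d) ℤ →* SLmod d n :=
  Matrix.SpecialLinearGroup.map (Int.castRingHom (ZMod n))

/-- Reduction modulo `n`, as a homomorphism `SL_d(ℤ/mℤ) → SL_d(ℤ/nℤ)`, when `n ∣ m`. -/
def redMod (d : ℕ) {n m : ℕ} (h : n ∣ m) : SLmod d m →* SLmod d n :=
  Matrix.SpecialLinearGroup.map (ZMod.castHom h (ZMod n))

open Classical in
/-- The invariant map `f_Z : G_n × G_m → {0,1}`, `f_Z(x,y) = 1` iff `π_n(y)⁻¹ x ∈ Z`. -/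
noncomputable def fZ (d : ℕ) {n m : ℕ} (hdvd : n ∣ m) (Z : Set (SLmod d n)) :
    SLmod d n × SLmod d m → Fin 2 :=
  fun p => if (redMod d hdvd p.2)⁻¹ * p.1 ∈ Z then 1 else 0

/-- The normalized Hamming distance `dist(f,g) = |{p : f p ≠ g p}| / (|G_n|·|G_m|)`
between maps `G_n × G_m → {0,1}`. -/
noncomputable def distFn (d n m : ℕ) (f g : SLmod d n × SLmod d m → Fin 2) : ℝ :=
  ({p | f p ≠ g p} : Set (SLmod d n × SLmod d m)).ncard /
    (Nat.card (SLmod d n) * Nat.card (SLmod d m))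

theorem redMod_redZ (d : ℕ) {n m : ℕ} (h : n ∣ m)
    (γ : Matrix.SpecialLinearGroup (Fin d) ℤ) :
    redMod d h (redZ d m γ) = redZ d n γ := by
  ext i j
  simp [redMod, redZ]

/-- A function `f : G_n × G_m → {0,1}` is invariant under the diagonal action
`γ·(x,y) = (π_n(γ)x, π_m(γ)y)` of `Γ` (with `π_m(Γ) = G_m`) iff `f = f_Z` for some
`Z ⊆ G_n`. -/
theorem invariant_iff_fZ (d n m : ℕ) (hd : 2 ≤ d) (hn : 2 ≤ n) (hm : 2 ≤ m)
    (hdvd : n ∣ m) (Γ : Subgroup (Matrix.SpecialLinearGroup (Fin d) ℤ))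
    (hsurj : Subgroup.map (redZ d m) Γ = ⊤)
    (f : SLmod d n × SLmod d m → Fin 2) :
    (∀ γ ∈ Γ, ∀ p : SLmod d n × SLmod d m,
        f (redZ d n γ * p.1, redZ d m γ * p.2) = f p) ↔
      ∃ Z : Set (SLmod d n), f = fZ d hdvd Z := by
  constructor
  · intro hf
    refine ⟨{z | f (z, 1) = 1}, funext fun p => ?_⟩
    obtain ⟨γ, hγ, hγp⟩ : p.2 ∈ Subgroup.map (redZ d m) Γ := hsurj ▸ Subgroup.mem_top _
    have key : f ((redMod d hdvd p.2)⁻¹ * p.1, 1) = f p := by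
      rw [← hf γ hγ ((redMod d hdvd p.2)⁻¹ * p.1, 1), ← hγp, redMod_redZ]
      simp [hγp]
    simp only [fZ, Set.mem_ofPred_eq, key]
    split_ifs with h
    · exact h
    · lia
  · rintro ⟨Z, rfl⟩ γ - p
    have key : (redMod d hdvd (redZ d m γ * p.2))⁻¹ * (redZ d n γ * p.1) =
        (redMod d hdvd p.2)⁻¹ * p.1 := by
      rw [map_mul, redMod_redZ, mul_inv_rev, mul_assoc, inv_mul_cancel_left]
    simp only [fZ]
    rw [key]
end

section
/- Let d ≥ 2, let n, m ≥ 2 be integers with n dividing m, let Γ ≤ SL_d(ℤ) be a countably infinite subgroup, and let S ⊆ Γ be a finite symmetric set such that h(G_m, π_m(S)) ≥ ε for some ε > 0. Set δ := ε/(32|S|). If f: G_n × G_m → {0,1} satisfies dist_∞(u, M^{α_n×α_m}_{S,2}[f]) < δ, then there exists a set Z ⊆ G_n such that dist(f, f_Z) < 1/16. -/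
/-- The vector `M^{α_n×α_m}_{S,2}[f] ∈ [0,1]^{S×2×2}`, where `α_n × α_m` is the diagonal
action on `G_n × G_m` with the uniform probability measure:  `M[f](γ,i,j)` is the
proportion of points `p ∈ G_n × G_m` with `f p = i` and `f (γ·p) = j`.
(The space `↥S × Fin 2 × Fin 2 → ℝ` carries the sup metric `dist_∞`.) -/
noncomputable def Mfin (d n m : ℕ) (S : Finset (Matrix.SpecialLinearGroup (Fin d) ℤ))
    (f : SLmod d n × SLmod d m → Fin 2) : ↥S × Fin 2 × Fin 2 → ℝ :=
  fun q => ({p : SLmod d n × SLmod d m | f p = q.2.1 ∧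
      f (redZ d n (q.1 : Matrix.SpecialLinearGroup (Fin d) ℤ) * p.1,
         redZ d m (q.1 : Matrix.SpecialLinearGroup (Fin d) ℤ) * p.2) = q.2.2}).ncard /
    (Nat.card (SLmod d n) * Nat.card (SLmod d m))

/-- The vector `u ∈ [0,1]^{S×2×2}` with `u(γ,i,j) = 1/2` if `i = j` and `= 0` otherwise. -/
noncomputable def uVec {Γ : Type*} (S : Finset Γ) : ↥S × Fin 2 × Fin 2 → ℝ :=
  fun q => if q.2.1 = q.2.2 then 1 / 2 else 0

/-- The boundary `∂(A,S) = {a ∈ A : S·a ⊄ A}` of a set `A` with respect to `S`. -/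
def bdry {G : Type*} [Group G] (A S : Set G) : Set G :=
  {a ∈ A | ¬ ∀ s ∈ S, s * a ∈ A}

/-- The Cheeger constant `h(G,S) = min { |∂(A,S)|/|A| : ∅ ≠ A ⊆ G, |A| ≤ |G|/2 }` of a
finite group `G` with respect to `S ⊆ G`. -/
noncomputable def cheeger (G : Type*) [Group G] [Finite G] (S : Set G) : ℝ :=
  sInf {r : ℝ | ∃ A : Set G, A.Nonempty ∧ 2 * A.ncard ≤ Nat.card G ∧
    r = (bdry A S).ncard / A.ncard}

/-- Counting in `K × H` along the cosets `{(π y * z, y) | y ∈ H}` of the graph of `π`. -/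
theorem ncard_eq_sum_ncard_graph_cosets {H K : Type*} [Group H] [Group K] [Finite H] [Fintype K]
    (π : H →* K) (P : K × H → Prop) :
    {p | P p}.ncard = ∑ z : K, {y | P (π y * z, y)}.ncard := by
  let e : {p // P p} ≃ Σ z : K, {y // P (π y * z, y)} :=
    { toFun := fun p => ⟨(π p.1.2)⁻¹ * p.1.1, p.1.2, by simpa using p.2⟩
      invFun := fun q => ⟨(π q.2.1 * q.1, q.2.1), q.2.2⟩
      left_inv := fun p => by simp
      right_inv := by
        rintro ⟨z, y, hy⟩
        exact Sigma.subtype_ext (inv_mul_cancel_left _ _) rfl }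
  have h := Nat.card_congr e
  rw [Nat.card_sigma] at h
  exact h

theorem mul_ncard_le_ncard_bdry {G : Type*} [Group G] [Finite G] {S : Set G} {ε : ℝ}
    (hε : ε ≤ cheeger G S) (A : Set G) (hA : 2 * A.ncard ≤ Nat.card G) :
    ε * A.ncard ≤ (bdry A S).ncard := by
  rcases A.eq_empty_or_nonempty with rfl | hne
  · simp
  have hpos : (0 : ℝ) < A.ncard := by exact_mod_cast hne.ncard_pos
  rw [← le_div_iff₀ hpos]
  refine hε.trans (csInf_le ⟨0, ?_⟩ ⟨A, hne, hA, rfl⟩)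
  rintro r ⟨B, -, -, rfl⟩
  positivity

theorem ncard_bdry_image_le_sum {ι G : Type*} [Group G] [Finite G] (ρ : ι → G) (S : Finset ι)
    (A : Set G) : (bdry A (ρ '' ↑S)).ncard ≤ ∑ s ∈ S, {a | a ∈ A ∧ ρ s * a ∉ A}.ncard := by
  have hsub : bdry A (ρ '' ↑S) ⊆ ⋃ s ∈ S, {a | a ∈ A ∧ ρ s * a ∉ A} := by
    rintro a ⟨ha, h⟩
    simp only [Set.forall_mem_image, not_forall] at h
    obtain ⟨s, hs, h⟩ := h
    exact Set.mem_biUnion hs ⟨ha, h⟩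
  exact (Set.ncard_le_ncard hsub (Set.toFinite _)).trans (Finset.set_ncard_biUnion_le _ _)

/-- A function `f : K × H → {0,1}` is close to its majority value on the cosets of the graph of
`π : H →* K`, in terms of how often `f` changes under translation by elements of `S`. -/
theorem exists_mul_ncard_ne_le_sum {ι H K : Type*} [Group H] [Group K] [Finite H] [Finite K]
    (π : H →* K) (ρ : ι → H) (S : Finset ι) {ε : ℝ} (hε : ε ≤ cheeger H (ρ '' ↑S))
    (f : K × H → Fin 2) :
    ∃ g : K → Fin 2, ε * {p : K × H | f p ≠ g ((π p.2)⁻¹ * p.1)}.ncard ≤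
      ∑ s ∈ S, ({p : K × H | f p ≠ f (π (ρ s) * p.1, ρ s * p.2)}.ncard : ℝ) := by
  have := Fintype.ofFinite K
  have hmaj : ∀ z : K, ∃ i : Fin 2, 2 * {y | f (π y * z, y) ≠ i}.ncard ≤ Nat.card H := by
    intro z
    by_contra! h
    have h0 := h 0
    have h1 := h 1
    have hc : {y | f (π y * z, y) ≠ 1} = {y | f (π y * z, y) ≠ 0}ᶜ := by
      ext y
      simp only [Set.mem_ofPred_eq, Set.mem_compl_iff]
      lia
    have := Set.ncard_add_ncard_compl {y | f (π y * z, y) ≠ 0}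
    rw [hc] at h1
    lia
  choose g hg using hmaj
  refine ⟨g, ?_⟩
  rw [ncard_eq_sum_ncard_graph_cosets π]
  simp_rw [ncard_eq_sum_ncard_graph_cosets π fun p => f p ≠ f (_ * p.1, _ * p.2)]
  simp only [inv_mul_cancel_left]
  push_cast
  rw [Finset.mul_sum, Finset.sum_comm]
  refine Finset.sum_le_sum fun z _ => (mul_ncard_le_ncard_bdry hε _ (hg z)).trans ?_
  have hle := ncard_bdry_image_le_sum ρ S {y | f (π y * z, y) ≠ g z}
  refine le_trans (Nat.cast_le.2 hle) ?_
  push_cast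
  refine Finset.sum_le_sum fun s _ => Nat.cast_le.2 (Set.ncard_le_ncard ?_ (Set.toFinite _))
  rintro y ⟨h1, h2⟩
  simp only [Set.mem_ofPred_eq, not_not, map_mul, mul_assoc] at h1 h2 ⊢
  rwa [h2]

theorem ncard_ne_translate_le (d n m : ℕ) [NeZero n] [NeZero m]
    (S : Finset (Matrix.SpecialLinearGroup (Fin d) ℤ)) (f : SLmod d n × SLmod d m → Fin 2)
    {γ : Matrix.SpecialLinearGroup (Fin d) ℤ} (hγ : γ ∈ S) :
    ({p : SLmod d n × SLmod d m | f p ≠ f (redZ d n γ * p.1, redZ d m γ * p.2)}.ncard : ℝ) ≤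
      2 * dist (uVec S) (Mfin d n m S f) * (Nat.card (SLmod d n) * Nat.card (SLmod d m)) := by
  have hN : (0 : ℝ) < Nat.card (SLmod d n) * Nat.card (SLmod d m) := by
    exact_mod_cast Nat.mul_pos Nat.card_pos Nat.card_pos
  have key : ∀ i j : Fin 2, i ≠ j →
      ({p : SLmod d n × SLmod d m | f p = i ∧
        f (redZ d n γ * p.1, redZ d m γ * p.2) = j}.ncard : ℝ) ≤
      dist (uVec S) (Mfin d n m S f) * (Nat.card (SLmod d n) * Nat.card (SLmod d m)) := by
    intro i j hij
    have h := dist_le_pi_dist (uVec S) (Mfin d n m S f) (⟨γ, hγ⟩, i, j)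
    simp only [uVec, hij, if_false, Real.dist_eq, zero_sub, abs_neg] at h
    exact (div_le_iff₀ hN).1 ((le_abs_self _).trans h)
  have hsub : {p : SLmod d n × SLmod d m | f p ≠ f (redZ d n γ * p.1, redZ d m γ * p.2)} ⊆
      {p | f p = 0 ∧ f (redZ d n γ * p.1, redZ d m γ * p.2) = 1} ∪
      {p | f p = 1 ∧ f (redZ d n γ * p.1, redZ d m γ * p.2) = 0} := by
    intro p hp
    simp only [Set.mem_ofPred_eq, Set.mem_union] at hp ⊢
    lia
  have hle := (Set.ncard_le_ncard hsub (Set.toFinite _)).trans (Set.ncard_union_le _ _)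
  have hle' := (Nat.cast_le (α := ℝ)).2 hle
  push_cast at hle'
  linarith [key 0 1 (by decide), key 1 0 (by decide)]

/-- Claim 5.6: if `S ⊆ Γ` is finite symmetric with `h(G_m, π_m(S)) ≥ ε`,
`δ = ε/(32|S|)`, and `f : G_n × G_m → {0,1}` satisfies
`dist_∞(u, M^{α_n×α_m}_{S,2}[f]) < δ`, then `dist(f, f_Z) < 1/16` for some `Z ⊆ G_n`. -/
theorem almost_invariant_close_to_invariant (d n m : ℕ) (hd : 2 ≤ d) (hn : 2 ≤ n)
    (hm : 2 ≤ m) (hdvd : n ∣ m) [NeZero n] [NeZero m]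
    (Γ : Subgroup (Matrix.SpecialLinearGroup (Fin d) ℤ)) (hinf : Infinite ↥Γ)
    (S : Finset (Matrix.SpecialLinearGroup (Fin d) ℤ))
    (hSsub : ↑S ⊆ (Γ : Set (Matrix.SpecialLinearGroup (Fin d) ℤ)))
    (hSsymm : ∀ γ ∈ S, γ⁻¹ ∈ S)
    (ε : ℝ) (hε : 0 < ε)
    (hcheeger : ε ≤ cheeger (SLmod d m) (⇑(redZ d m) '' ↑S))
    (f : SLmod d n × SLmod d m → Fin 2)
    (hf : dist (uVec S) (Mfin d n m S f) < ε / (32 * S.card)) :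
    ∃ Z : Set (SLmod d n), distFn d n m f (fZ d hdvd Z) < 1 / 16 := by
  have hN : (0 : ℝ) < Nat.card (SLmod d n) * Nat.card (SLmod d m) := by
    exact_mod_cast Nat.mul_pos Nat.card_pos Nat.card_pos
  have hS : (0 : ℝ) < S.card := by
    refine lt_of_le_of_ne (Nat.cast_nonneg _) fun h => ?_
    rw [← h, mul_zero, div_zero] at hf
    exact absurd hf (not_lt.2 dist_nonneg)
  obtain ⟨g, hg⟩ := exists_mul_ncard_ne_le_sum (redMod d hdvd) (redZ d m) S hcheeger f
  simp_rw [redMod_redZ] at hg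
  have hsum := hg.trans (Finset.sum_le_sum fun γ hγ => ncard_ne_translate_le d n m S f hγ)
  rw [Finset.sum_const, nsmul_eq_mul] at hsum
  refine ⟨{z | g z = 1}, ?_⟩
  have hfZ : fZ d hdvd {z | g z = 1} = fun p => g ((redMod d hdvd p.2)⁻¹ * p.1) := by
    funext p
    simp only [fZ, Set.mem_ofPred_eq]
    split_ifs <;> lia
  rw [distFn, hfZ, div_lt_iff₀ hN]
  rw [lt_div_iff₀ (by positivity)] at hf
  refine lt_of_mul_lt_mul_left (hsum.trans_lt ?_) hε.le
  nlinarith [mul_lt_mul_of_pos_right hf hN]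
end

section
/- Let d ≥ 2, let n, m ≥ 2 be integers with n dividing m, let p be the smallest prime divisor of n, and set N := ⌊√(p−1)/25⌋; assume N ≥ 1. Let f: G_n × G_m → {0,1} be an N-step function, i.e., f(x,y) = φ(g(x),h(y)) for some g: G_n → {0,…,N−1}, h: G_m → {0,…,N−1}, and φ: N×N → {0,1}. If Z ⊆ G_n satisfies min{|Z|, |G_n| − |Z|} ≥ |G_n|/4, then dist(f, f_Z) ≥ 1/8. -/
theorem exists_isUnit_add_mul_of_finite {R : Type*} [CommRing R] [Finite R] {a b w : R}
    (h : w * a + b = 1) : ∃ t, IsUnit (a + t * b) := by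
  obtain ⟨K, hK⟩ : ∃ K : ℕ, a ^ (K + 1) * a ^ (K + 1) = a ^ (K + 1) := by
    obtain ⟨i, j, hij, he⟩ := Finite.exists_ne_map_eq_of_infinite (fun i : ℕ => a ^ i)
    wlog hlt : i < j generalizing i j
    · exact this j i hij.symm he.symm (by omega)
    obtain ⟨k, rfl⟩ := Nat.exists_eq_add_of_lt hlt
    have key : ∀ q r : ℕ, i ≤ r → a ^ (r + q * (k + 1)) = a ^ r := by
      intro q
      induction q with
      | zero => simp
      | succ q ih =>
        intro r hr
        rw [← ih r hr]
        obtain ⟨s, rfl⟩ := Nat.exists_eq_add_of_le hr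
        have : a ^ i = a ^ (i + k + 1) := he
        calc a ^ (i + s + (q + 1) * (k + 1))
            = a ^ (i + k + 1) * a ^ (s + q * (k + 1)) := by rw [← pow_add]; congr 1; ring
          _ = a ^ (i + s + q * (k + 1)) := by rw [← this, ← pow_add]; congr 1; ring
    refine ⟨(i + 1) * (k + 1) - 1, ?_⟩
    have h1 : (i + 1) * (k + 1) - 1 + 1 = (i + 1) * (k + 1) :=
      Nat.sub_add_cancel (Nat.mul_pos (by omega) (by omega))
    rw [h1, ← pow_add]
    exact key (i + 1) _ (by nlinarith)
  set e := a ^ (K + 1) with he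
  obtain ⟨c, hc⟩ : b ∣ 1 - (w * a) ^ (K + 1) := by
    have := sub_dvd_pow_sub_pow (1 : R) (w * a) (K + 1)
    rwa [one_pow, show 1 - w * a = b by linear_combination -h] at this
  rw [mul_pow, ← he] at hc
  refine ⟨(1 - e) * (1 - a) * c, IsUnit.of_mul_eq_one (a ^ K * e + (1 - e)) ?_⟩
  have h2 : a ^ K * a = e := by rw [he, pow_succ]
  have h3 : a + (1 - e) * (1 - a) * c * b = 1 - e + e * a := by
    linear_combination -(1 - e) * (1 - a) * hc + (1 - a) * w ^ (K + 1) * hK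
  rw [h3]
  linear_combination e * e * h2 + (2 - a - a ^ K + e) * hK

namespace Matrix.SpecialLinearGroup

variable {ι R : Type*} [DecidableEq ι] [Fintype ι] [CommRing R]

/-- The subgroup of `SL(ι, R)` generated by the transvections. -/
def elementary (ι R : Type*) [DecidableEq ι] [Fintype ι] [CommRing R] :
    Subgroup (SpecialLinearGroup ι R) :=
  Subgroup.closure {A | ∃ (i j : ι) (hij : i ≠ j) (c : R), A = transvection hij c}

theorem transvection_mem_elementary {i j : ι} (hij : i ≠ j) (c : R) :
    transvection hij c ∈ elementary ι R :=
  Subgroup.subset_closure ⟨i, j, hij, c, rfl⟩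

theorem transvection_mul_apply {i j : ι} (hij : i ≠ j) (c : R) (A : SpecialLinearGroup ι R)
    (l m : ι) :
    (transvection hij c * A) l m = if l = i then A i m + c * A j m else A l m := by
  change (Matrix.transvection i j c * (A : Matrix ι ι R)) l m = _
  split_ifs with h
  · rw [h, Matrix.transvection_mul_apply_same]
  · rw [Matrix.transvection_mul_apply_of_ne _ _ _ _ h]

/-- Adding a linear combination of the other rows to row `k`. -/
theorem exists_elementary_add_to_row (k : ι) (t : ι → R) (s : Finset ι) (hk : k ∉ s)
    (A : SpecialLinearGroup ι R) :
    ∃ B ∈ elementary ι R, ∀ l m,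
      (B * A) l m = if l = k then A k m + ∑ i ∈ s, t i * A i m else A l m := by
  induction s using Finset.induction_on with
  | empty => exact ⟨1, one_mem _, fun l m => by split_ifs with h <;> simp [h]⟩
  | insert i s hi ih =>
    have hki : k ≠ i := fun h => hk (by simp [h])
    obtain ⟨B, hB, hBA⟩ := ih (fun h => hk (Finset.mem_insert_of_mem h))
    refine ⟨transvection hki (t i) * B, mul_mem (transvection_mem_elementary _ _) hB, ?_⟩
    intro l m
    rw [mul_assoc, transvection_mul_apply, Finset.sum_insert hi]
    simp only [hBA]
    simp only [if_true, hki.symm, if_false]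
    split_ifs with h
    · ring
    · rfl

/-- Adding multiples of row `k` to the other rows. -/
theorem exists_elementary_add_from_row (k : ι) (t : ι → R) (s : Finset ι) (hk : k ∉ s)
    (A : SpecialLinearGroup ι R) :
    ∃ B ∈ elementary ι R, ∀ l m,
      (B * A) l m = if l ∈ s then A l m + t l * A k m else A l m := by
  induction s using Finset.induction_on with
  | empty => exact ⟨1, one_mem _, fun l m => by simp⟩
  | insert i s hi ih =>
    have hki : i ≠ k := fun h => hk (by simp [h])
    have hks : k ∉ s := fun h => hk (Finset.mem_insert_of_mem h)
    obtain ⟨B, hB, hBA⟩ := ih hks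
    refine ⟨transvection hki (t i) * B, mul_mem (transvection_mem_elementary _ _) hB, ?_⟩
    intro l m
    rw [mul_assoc, transvection_mul_apply]
    simp only [hBA, if_neg hi, if_neg hks, Finset.mem_insert]
    by_cases h : l = i
    · simp [h]
    · simp [h]

theorem map_transvection {S : Type*} [CommRing S] (f : R →+* S) {i j : ι} (hij : i ≠ j) (c : R) :
    SpecialLinearGroup.map f (transvection hij c) = transvection hij (f c) := by
  ext l m
  simp [transvection_coe, Matrix.one_apply, Matrix.single_apply, apply_ite f]

/-- A special linear matrix whose first `k` columns are those of the identity, over a finite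
ring, is a product of transvections. -/
theorem mem_elementary_of_finite [Finite R] {d : ℕ} (k : ℕ) (hk : k ≤ d)
    (A : SpecialLinearGroup (Fin d) R)
    (hA : ∀ i j : Fin d, (j : ℕ) < k → A i j = (1 : Matrix (Fin d) (Fin d) R) i j) :
    A ∈ elementary (Fin d) R := by
  induction hk using Nat.decreasingInduction generalizing A with
  | self =>
    have : A = 1 := by
      ext i j
      simpa using hA i j j.2
    rw [this]
    exact one_mem _
  | of_succ k hk ih =>
    let c : Fin d := ⟨k, hk⟩
    suffices h1 : ∃ B ∈ elementary (Fin d) R,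
        (∀ i j : Fin d, (j : ℕ) < k → (B * A) i j = (1 : Matrix (Fin d) (Fin d) R) i j) ∧
        (B * A) c c = 1 by
      obtain ⟨B, hB, hBA, hc⟩ := h1
      obtain ⟨C, hC, hCA⟩ := exists_elementary_add_from_row c (fun l => - (B * A) l c)
        (Finset.univ.erase c) (by simp) (B * A)
      have h2 : C * (B * A) ∈ elementary (Fin d) R := by
        refine ih _ fun i j hj => ?_
        rw [hCA]
        rcases Nat.lt_succ_iff_lt_or_eq.mp hj with hj | hj
        · have hcj : c ≠ j := fun h => by simp [← h, c] at hj
          rw [hBA _ _ hj, hBA _ _ hj, Matrix.one_apply_ne hcj]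
          simp
        · obtain rfl : j = c := Fin.ext hj
          by_cases hi : i = c
          · subst hi; simp [hc]
          · simp [hi, hc]
      exact (Subgroup.mul_mem_cancel_left _ hB).1 ((Subgroup.mul_mem_cancel_left _ hC).1 h2)
    by_cases hlast : k + 1 = d
    · refine ⟨1, one_mem _, by simpa using hA, ?_⟩
      have htri : (A : Matrix (Fin d) (Fin d) R).IsUpperTriangular := by
        intro i j hij
        have hij' : j < i := hij
        rw [hA i j (by omega), Matrix.one_apply_ne hij'.ne']
      have hdet := Matrix.det_of_isUpperTriangular htri
      rw [A.2, Finset.prod_eq_single c] at hdet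
      · simpa using hdet.symm
      · intro i _ hi
        have : (i : ℕ) ≠ k := fun h => hi (Fin.ext h)
        rw [hA i i (by omega), Matrix.one_apply_eq]
      · simp
    · let c' : Fin d := ⟨k + 1, by omega⟩
      have hcc' : c ≠ c' := by simp [c, c']
      obtain ⟨w, hw⟩ : ∃ w : Fin d → R, ∀ j, ∑ i, w i * A i j =
          (1 : Matrix (Fin d) (Fin d) R) c j := by
        refine ⟨fun i => A⁻¹ c i, fun j => ?_⟩
        have : ((A⁻¹ * A : SpecialLinearGroup (Fin d) R) : Matrix (Fin d) (Fin d) R) c j =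
          (1 : Matrix (Fin d) (Fin d) R) c j := by simp
        rw [← this]
        rfl
      have hw0 : ∀ j : Fin d, (j : ℕ) < k → w j = 0 := by
        intro j hj
        have h1 := hw j
        have hcj : c ≠ j := fun h => by simp [← h, c] at hj
        simp only [hA _ j hj, Matrix.one_apply_ne hcj, Matrix.one_apply] at h1
        simpa using h1
      let s : Finset (Fin d) := Finset.univ.filter fun i => c < i
      have hunit : w c * A c c + ∑ i ∈ s, w i * A i c = 1 := by
        have h1 := hw c
        rw [Matrix.one_apply_eq] at h1
        refine Eq.trans ?_ h1
        rw [← Finset.sum_insert (f := fun i => w i * A i c) (by simp [s])]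
        refine Finset.sum_subset (Finset.subset_univ _) fun i _ hi => ?_
        rw [hw0 i, zero_mul]
        by_contra hlt
        apply hi
        rcases eq_or_ne i c with h | h
        · simp [h]
        · have : (i : ℕ) ≠ k := fun h' => h (Fin.ext h')
          simp only [s, Finset.mem_insert, Finset.mem_filter, Finset.mem_univ, true_and]
          right
          rw [Fin.lt_def]
          simp only [c]
          omega
      obtain ⟨t, ht⟩ := exists_isUnit_add_mul_of_finite hunit
      have hcol : ∀ i j : Fin d, (j : ℕ) < k → c ≤ i → A i j = 0 := by
        intro i j hj hi
        rw [Fin.le_def] at hi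
        simp only [c] at hi
        rw [hA i j hj, Matrix.one_apply_ne]
        intro h
        rw [h] at hi
        omega
      obtain ⟨B₁, hB₁, h₁⟩ := exists_elementary_add_to_row c (fun i => t * w i) s (by simp [s]) A
      have h₁' : (B₁ * A) c c = A c c + t * ∑ i ∈ s, w i * A i c := by
        rw [h₁, if_pos rfl, Finset.mul_sum]
        simp only [mul_assoc]
      rw [← h₁'] at ht
      obtain ⟨v, hv⟩ := ht.exists_left_inv
      have hstd : ∀ i j : Fin d, (j : ℕ) < k →
          (B₁ * A) i j = (1 : Matrix (Fin d) (Fin d) R) i j := by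
        intro i j hj
        rw [h₁, ← hA i j hj]
        split_ifs with hi
        · subst hi
          rw [Finset.sum_eq_zero, add_zero]
          intro l hl
          rw [hcol l j hj (Finset.mem_filter.1 hl).2.le, mul_zero]
        · rfl
      set A₁ := B₁ * A
      refine ⟨transvection hcc' (1 - A₁ c c) *
        (transvection hcc'.symm (v * (1 - A₁ c' c)) * B₁),
        mul_mem (transvection_mem_elementary _ _)
          (mul_mem (transvection_mem_elementary _ _) hB₁), ?_, ?_⟩
      · intro i j hj
        have e1 : A₁ c j = 0 := by
          rw [hstd _ _ hj, Matrix.one_apply_ne]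
          exact fun h => by simp [← h, c] at hj
        have e2 : A₁ c' j = 0 := by
          rw [hstd _ _ hj, Matrix.one_apply_ne]
          exact fun h => by simp [← h, c'] at hj
        rw [mul_assoc, mul_assoc, transvection_mul_apply]
        simp only [transvection_mul_apply, ← hstd i j hj]
        simp only [show B₁ * A = A₁ from rfl, e1, e2, hcc', if_true, if_false, mul_zero, add_zero]
        split_ifs with h h' <;> simp_all
      · rw [mul_assoc, mul_assoc, transvection_mul_apply]
        simp only [transvection_mul_apply]
        simp only [show B₁ * A = A₁ from rfl, hcc', if_true, if_false]
        linear_combination (1 - A₁ c c) * (1 - A₁ c' c) * hv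

theorem elementary_eq_top_of_finite [Finite R] (d : ℕ) : elementary (Fin d) R = ⊤ :=
  eq_top_iff.2 fun A _ => mem_elementary_of_finite 0 (Nat.zero_le d) A
    fun _ _ hj => absurd hj (Nat.not_lt_zero _)

theorem map_surjective_of_finite {S : Type*} [CommRing S] [Finite S] (d : ℕ) {f : R →+* S}
    (hf : Function.Surjective f) :
    Function.Surjective (SpecialLinearGroup.map f :
      SpecialLinearGroup (Fin d) R →* SpecialLinearGroup (Fin d) S) := by
  rw [← MonoidHom.range_eq_top, eq_top_iff, ← elementary_eq_top_of_finite d]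
  refine (Subgroup.closure_le _).2 ?_
  rintro _ ⟨i, j, hij, c, rfl⟩
  obtain ⟨b, rfl⟩ := hf c
  exact ⟨transvection hij b, map_transvection f hij b⟩

theorem transvection_pow {i j : ι} (hij : i ≠ j) (c : R) (k : ℕ) :
    transvection hij c ^ k = transvection hij (k * c) := by
  induction k with
  | zero => simp
  | succ k ih => rw [pow_succ, ih, ← transvection_add]; congr 1; push_cast; ring

theorem exists_transvection_mul_eq_mul_pow {i j : ι} (hij : i ≠ j) (c : R) (a : ℕ)
    (ha : IsUnit (a : R)) :
    ∃ g : SpecialLinearGroup ι R,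
      transvection hij c * g = g * transvection hij c ^ (a ^ 2) := by
  obtain ⟨b, hb⟩ := ha.exists_left_inv
  let D : ι → R := Function.update (Function.update 1 i b) j (a : R)
  have hDi : D i = b := by simp [D, Function.update_of_ne hij]
  have hDj : D j = a := by simp [D]
  have hD : (Matrix.diagonal D).det = 1 := by
    rw [Matrix.det_diagonal, ← Finset.mul_prod_erase _ _ (Finset.mem_univ i),
      ← Finset.mul_prod_erase _ _ (Finset.mem_erase.2 ⟨hij.symm, Finset.mem_univ j⟩), hDi, hDj,
      Finset.prod_eq_one, mul_one, hb]
    intro l hl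
    simp only [Finset.mem_erase] at hl
    simp [D, hl.1, hl.2.1]
  refine ⟨⟨Matrix.diagonal D, hD⟩, ?_⟩
  rw [transvection_pow]
  ext l m
  change ((1 + Matrix.single i j c) * Matrix.diagonal D) l m =
    (Matrix.diagonal D * (1 + Matrix.single i j (((a ^ 2 : ℕ) : R) * c))) l m
  simp only [Matrix.mul_diagonal, Matrix.diagonal_mul, Matrix.add_apply, Matrix.one_apply,
    Matrix.single_apply]
  by_cases hl : i = l ∧ j = m
  · obtain ⟨rfl, rfl⟩ := hl
    simp only [hij, hDi, hDj]
    push_cast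
    simp only [and_self, if_true, zero_add]
    linear_combination -(a * c) * hb
  · rw [if_neg hl, if_neg hl]
    by_cases hlm : l = m
    · subst hlm; simp
    · simp [hlm]

end Matrix.SpecialLinearGroup

open Module in
theorem Module.End.exists_hasEigenvector_ne_one {V : Type*} [AddCommGroup V] [Module ℂ V]
    [FiniteDimensional ℂ V] {n : ℕ} (hn : n ≠ 0) {A : End ℂ V} (hA : A ^ n = 1) (hA1 : A ≠ 1) :
    ∃ μ : ℂ, ∃ w : V, A.HasEigenvector μ w ∧ μ ≠ 1 ∧ μ ^ n = 1 := by
  have hinv : ∀ w ∈ LinearMap.range (A - 1), A w ∈ LinearMap.range (A - 1) := by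
    rintro _ ⟨v, rfl⟩
    exact ⟨A v, by simp⟩
  have : Nontrivial (LinearMap.range (A - 1)) := by
    rw [Submodule.nontrivial_iff_ne_bot, Ne, LinearMap.range_eq_bot]
    exact sub_ne_zero.2 hA1
  obtain ⟨μ, hμ⟩ := End.exists_eigenvalue (A.restrict hinv)
  obtain ⟨w, hw⟩ := hμ.exists_hasEigenvector
  have hwA : A w = μ • (w : V) := congrArg Subtype.val hw.apply_eq_smul
  have hw0 : (w : V) ≠ 0 := fun h => hw.2 (Subtype.ext h)
  have hev : A.HasEigenvector μ (w : V) := ⟨End.mem_eigenspace_iff.2 hwA, hw0⟩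
  have hpow : ∀ k, (A ^ k) (w : V) = μ ^ k • (w : V) := fun k => hev.pow_apply k
  refine ⟨μ, w, hev, ?_, ?_⟩
  · rintro rfl
    obtain ⟨v, hv⟩ := w.2
    have h1 : (∑ k ∈ Finset.range n, A ^ k) (w : V) = 0 := by
      rw [← hv, ← Module.End.mul_apply, geom_sum_mul, hA, sub_self, LinearMap.zero_apply]
    rw [LinearMap.sum_apply] at h1
    simp only [hpow, one_pow, one_smul, Finset.sum_const, Finset.card_range] at h1
    rw [← Nat.cast_smul_eq_nsmul ℂ, smul_eq_zero, Nat.cast_eq_zero] at h1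
    exact h1.elim hn hw0
  · have h1 := hpow n
    rw [hA, Module.End.one_apply] at h1
    by_contra hne
    have : (μ ^ n - 1) • (w : V) = 0 := by rw [sub_smul, ← h1, one_smul, sub_self]
    exact (smul_eq_zero.1 this).elim (sub_ne_zero.2 hne) hw0

open Module in
/-- A nontrivial operator of order dividing `n` which is conjugate to its `a²`-th powers, for all
`a` coprime to `n`, acts on a space of dimension at least `(p - 1) / 2`, where `p` is the smallest
prime factor of `n`. -/
theorem Module.End.minFac_le_finrank_of_conj_pow {V : Type*} [AddCommGroup V] [Module ℂ V]
    [FiniteDimensional ℂ V] {n : ℕ} (hn : n ≠ 0) {A : End ℂ V} (hA : A ^ n = 1) (hA1 : A ≠ 1)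
    (hconj : ∀ a : ℕ, a.Coprime n →
      ∃ C : End ℂ V, Function.Injective C ∧ A * C = C * A ^ (a ^ 2)) :
    (n.minFac - 1) / 2 ≤ finrank ℂ V := by
  obtain ⟨μ, w, hev, hμ1, hμn⟩ := exists_hasEigenvector_ne_one hn hA hA1
  have hord : orderOf μ ≠ 1 := by rwa [Ne, orderOf_eq_one_iff]
  have hq : (orderOf μ).minFac.Prime := Nat.minFac_prime hord
  have hqμ : (orderOf μ).minFac ∣ orderOf μ := Nat.minFac_dvd _
  have hle : n.minFac ≤ (orderOf μ).minFac :=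
    Nat.minFac_le_of_dvd hq.two_le (hqμ.trans (orderOf_dvd_of_pow_eq_one hμn))
  have hμ0 : μ ≠ 0 := by
    rintro rfl
    rw [zero_pow hn] at hμn
    exact zero_ne_one hμn
  have hinj : ∀ a b : ℕ, a < b → b < (n.minFac - 1) / 2 →
      μ ^ ((a + 1) ^ 2) ≠ μ ^ ((b + 1) ^ 2) := by
    intro a b hab hb h
    have h1 : μ ^ ((b + 1) ^ 2 - (a + 1) ^ 2) = 1 := by
      rw [pow_sub₀ _ hμ0 (by gcongr), h, mul_inv_cancel₀ (pow_ne_zero _ hμ0)]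
    have h2 := hqμ.trans (orderOf_dvd_of_pow_eq_one h1)
    rw [Nat.sq_sub_sq] at h2
    rcases (Nat.Prime.dvd_mul hq).1 h2 with h3 | h3
    · have := Nat.le_of_dvd (by omega) h3
      omega
    · have := Nat.le_of_dvd (by omega) h3
      omega
  have hcop : ∀ a : Fin ((n.minFac - 1) / 2), ((a : ℕ) + 1).Coprime n := by
    intro a
    by_contra hne
    obtain ⟨r, hr, h1, h2⟩ := Nat.Prime.not_coprime_iff_dvd.1 hne
    have h3 := Nat.minFac_le_of_dvd hr.two_le h2
    have h4 := Nat.le_of_dvd (by omega) h1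
    have := a.2
    omega
  choose C hC hAC using fun a => hconj _ (hcop a)
  have hli := Module.End.eigenvectors_linearIndependent' A
    (fun a : Fin ((n.minFac - 1) / 2) => μ ^ (((a : ℕ) + 1) ^ 2))
    (fun a b h => by
      rcases lt_trichotomy (a : ℕ) b with hab | hab | hab
      · exact absurd h (hinj _ _ hab b.2)
      · exact Fin.ext hab
      · exact absurd h.symm (hinj _ _ hab a.2))
    (fun a => C a w)
    (fun a => by
      refine ⟨End.mem_eigenspace_iff.2 ?_, fun h => hev.2 (hC a (h.trans (map_zero _).symm))⟩
      rw [← Module.End.mul_apply, hAC, Module.End.mul_apply, hev.pow_apply, map_smul])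
  simpa using hli.fintype_card_le_finrank

open Module Matrix.SpecialLinearGroup in
theorem Representation.eq_one_of_finrank_lt {d n : ℕ} (hn : 2 ≤ n) {V : Type*} [AddCommGroup V]
    [Module ℂ V] [FiniteDimensional ℂ V]
    (ρ : Representation ℂ (Matrix.SpecialLinearGroup (Fin d) (ZMod n)) V)
    (hV : finrank ℂ V < (n.minFac - 1) / 2)
    (g : Matrix.SpecialLinearGroup (Fin d) (ZMod n)) : ρ g = 1 := by
  have : NeZero n := ⟨by omega⟩
  suffices h : elementary (Fin d) (ZMod n) ≤ MonoidHom.ker ρ by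
    rw [elementary_eq_top_of_finite] at h
    exact h (Subgroup.mem_top g)
  refine (Subgroup.closure_le _).2 ?_
  rintro _ ⟨i, j, hij, c, rfl⟩
  by_contra hne
  refine hV.not_ge (End.minFac_le_finrank_of_conj_pow (A := ρ (transvection hij c))
    (by omega) ?_ hne ?_)
  · rw [← map_pow, transvection_pow, CharP.cast_eq_zero, zero_mul, transvection_coeff_zero,
      map_one]
  · intro a ha
    obtain ⟨g, hg⟩ := exists_transvection_mul_eq_mul_pow hij c a
      ((ZMod.isUnit_iff_coprime a n).2 ha)
    refine ⟨ρ g, (ρ.apply_bijective g).1, ?_⟩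
    rw [← map_pow, ← map_mul, ← map_mul, hg]

open Module in
theorem finrank_mul_le_sum_norm_sq {F H : Type*} [Fintype F] [NormedAddCommGroup H]
    [InnerProductSpace ℂ H] (t : F → H) (E : Submodule ℂ H) [FiniteDimensional ℂ E] {lam : ℝ}
    (hE : ∀ u ∈ E, ∑ y, ‖inner ℂ (t y) u‖ ^ 2 = lam * ‖u‖ ^ 2) :
    finrank ℂ E * lam ≤ ∑ y, ‖t y‖ ^ 2 := by
  let e := stdOrthonormalBasis ℂ E
  have heo : Orthonormal ℂ fun k => (e k : H) := e.orthonormal.comp_linearIsometry E.subtypeₗᵢ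
  calc (finrank ℂ E : ℝ) * lam
      = ∑ k, ∑ y, ‖inner ℂ (t y) (e k : H)‖ ^ 2 := by
        simp [hE _ (e _).2, heo.1]
    _ = ∑ y, ∑ k, ‖inner ℂ (e k : H) (t y)‖ ^ 2 := by
        rw [Finset.sum_comm]
        exact Finset.sum_congr rfl fun y _ => Finset.sum_congr rfl fun k _ => by
          rw [norm_inner_symm]
    _ ≤ ∑ y, ‖t y‖ ^ 2 := Finset.sum_le_sum fun y _ => heo.sum_inner_products_le (t y)

namespace LeftTranslation

variable {G : Type*} [Group G] [Fintype G]

/-- Left translation of functions on a finite group. -/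
noncomputable def translate (g : G) : EuclideanSpace ℂ G ≃ₗᵢ[ℂ] EuclideanSpace ℂ G :=
  LinearIsometryEquiv.piLpCongrLeft 2 ℂ ℂ (Equiv.mulLeft g)

theorem translate_apply (g : G) (v : EuclideanSpace ℂ G) (x : G) :
    translate g v x = v (g⁻¹ * x) := rfl

theorem translate_one (v : EuclideanSpace ℂ G) : translate 1 v = v := by
  ext x
  simp [translate_apply]

theorem translate_mul (g h : G) (v : EuclideanSpace ℂ G) :
    translate (g * h) v = translate g (translate h v) := by
  ext x
  simp [translate_apply, mul_assoc]

/-- The left regular representation restricted to an invariant subspace. -/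
noncomputable def subrep (E : Submodule ℂ (EuclideanSpace ℂ G))
    (hE : ∀ g, ∀ v ∈ E, translate g v ∈ E) : Representation ℂ G E where
  toFun g := (translate g).toLinearEquiv.toLinearMap.restrict (hE g)
  map_one' := by
    ext1 v
    exact Subtype.ext (translate_one _)
  map_mul' g h := by
    ext1 v
    exact Subtype.ext (translate_mul g h _)

open Module in
/-- An invariant subspace of too small dimension consists of constant functions. -/
theorem eq_const_of_finrank_lt {D : ℕ}
    (hD : ∀ (E : Submodule ℂ (EuclideanSpace ℂ G)) (ρ : Representation ℂ G E),
      finrank ℂ E < D → ∀ g, ρ g = 1)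
    (E : Submodule ℂ (EuclideanSpace ℂ G)) (hE : ∀ g, ∀ v ∈ E, translate g v ∈ E)
    (hED : finrank ℂ E < D) {v : EuclideanSpace ℂ G} (hv : v ∈ E) (x : G) : v x = v 1 := by
  have h := hD E (subrep E hE) hED x⁻¹
  have h1 : translate x⁻¹ v = v := congrArg Subtype.val (LinearMap.congr_fun h ⟨v, hv⟩)
  conv_rhs => rw [← h1, translate_apply]
  simp

open Module in
/-- The spectral bound: the frame operator of an orbit of a mean zero function on a quasirandom
group has small norm. -/
theorem sum_inner_sq_mul_le {F : Type*} [Group F] [Fintype F] (π : F →* G)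
    (hπ : Function.Surjective π) {D : ℕ}
    (hD : ∀ (E : Submodule ℂ (EuclideanSpace ℂ G)) (ρ : Representation ℂ G E),
      finrank ℂ E < D → ∀ g, ρ g = 1)
    (z : EuclideanSpace ℂ G) (hz : ∑ x, z x = 0) (v : EuclideanSpace ℂ G) :
    (∑ y, ‖inner ℂ (translate (π y) z) v‖ ^ 2) * D ≤
      (Fintype.card F * ‖z‖ ^ 2) * ‖v‖ ^ 2 := by
  let t : F → EuclideanSpace ℂ G := fun y => translate (π y) z
  have ht : ∀ y, ‖t y‖ = ‖z‖ := fun y => (translate (π y)).norm_map z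
  let S : EuclideanSpace ℂ G →ₗ[ℂ] EuclideanSpace ℂ G :=
    ∑ y, ((innerSL ℂ (t y)).toLinearMap).smulRight (t y)
  have hS : ∀ v, S v = ∑ y, inner ℂ (t y) v • t y := fun v => by
    simp [S, LinearMap.sum_apply]
  have hSsymm : S.IsSymmetric := by
    intro u v
    rw [hS, hS, sum_inner, inner_sum]
    refine Finset.sum_congr rfl fun y _ => ?_
    rw [inner_smul_left, inner_smul_right, inner_conj_symm, mul_comm]
  have hSre : ∀ v, RCLike.re (inner ℂ (S v) v) = ∑ y, ‖inner ℂ (t y) v‖ ^ 2 := by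
    intro v
    rw [hS, sum_inner, map_sum]
    refine Finset.sum_congr rfl fun y _ => ?_
    rw [inner_smul_left, RCLike.conj_mul, ← RCLike.ofReal_pow, RCLike.ofReal_re]
  have hStrans : ∀ g v, S (translate g v) = translate g (S v) := by
    intro g v
    obtain ⟨w, rfl⟩ := hπ g
    rw [hS, hS, map_sum, ← Equiv.sum_comp (Equiv.mulLeft w)]
    refine Finset.sum_congr rfl fun y _ => ?_
    have : t (w * y) = translate (π w) (t y) := by
      simp only [t, map_mul, translate_mul]
    simp only [Equiv.coe_mulLeft]
    rw [this, LinearIsometryEquiv.inner_map_map, map_smul]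
  have hbound : ∀ v, RCLike.re (inner ℂ (S v) v) ≤ (Fintype.card F * ‖z‖ ^ 2) * ‖v‖ ^ 2 := by
    intro v
    rw [hSre]
    calc ∑ y, ‖inner ℂ (t y) v‖ ^ 2 ≤ ∑ _y : F, ‖z‖ ^ 2 * ‖v‖ ^ 2 := by
          refine Finset.sum_le_sum fun y _ => ?_
          rw [← mul_pow, ← ht y]
          gcongr
          exact norm_inner_le_norm _ _
      _ = _ := by simp [mul_assoc]
  set lam : ℝ := ⨆ x : { x : EuclideanSpace ℂ G // x ≠ 0 },
    RCLike.re (inner ℂ (S x) x) / ‖(x : EuclideanSpace ℂ G)‖ ^ 2 with hlam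
  have hlev : End.HasEigenvalue S (lam : ℂ) := hSsymm.hasEigenvalue_iSup_of_finiteDimensional
  have hray : ∀ v, ∑ y, ‖inner ℂ (t y) v‖ ^ 2 ≤ lam * ‖v‖ ^ 2 := by
    intro v
    rcases eq_or_ne v 0 with rfl | hv
    · simp
    · have hv' : 0 < ‖v‖ ^ 2 := by positivity
      rw [← div_le_iff₀ hv', ← hSre]
      refine le_ciSup (f := fun x : { x : EuclideanSpace ℂ G // x ≠ 0 } =>
        RCLike.re (inner ℂ (S x) x) / ‖(x : EuclideanSpace ℂ G)‖ ^ 2)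
        ⟨Fintype.card F * ‖z‖ ^ 2, ?_⟩ ⟨v, hv⟩
      rintro _ ⟨x, rfl⟩
      have hx : 0 < ‖(x : EuclideanSpace ℂ G)‖ ^ 2 := by have := x.2; positivity
      exact (div_le_iff₀ hx).2 (hbound x)
  have hlamD : lam * D ≤ Fintype.card F * ‖z‖ ^ 2 := by
    by_cases hED : finrank ℂ (End.eigenspace S (lam : ℂ)) < D
    · obtain ⟨u, hu, hu0⟩ := hlev.exists_hasEigenvector
      have hc := eq_const_of_finrank_lt hD _ (fun g v hv => by
        rw [End.mem_eigenspace_iff] at hv ⊢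
        rw [hStrans, hv, map_smul]) hED hu
      have hin : ∀ y, inner ℂ (t y) u = 0 := by
        intro y
        rw [PiLp.inner_apply]
        simp only [hc, RCLike.inner_apply, t, translate_apply]
        have hz' : ∑ x, z ((π y)⁻¹ * x) = 0 :=
          (Equiv.sum_comp (Equiv.mulLeft (π y)⁻¹) fun x => z x).trans hz
        rw [← Finset.mul_sum, ← map_sum, hz', map_zero, mul_zero]
      have hSu : S u = 0 := by rw [hS]; simp [hin]
      rw [End.mem_eigenspace_iff.1 hu, smul_eq_zero] at hSu
      have : lam = 0 := by exact_mod_cast hSu.resolve_right hu0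
      rw [this, zero_mul]
      positivity
    · rw [not_lt] at hED
      have hsum := finrank_mul_le_sum_norm_sq t (End.eigenspace S (lam : ℂ)) (lam := lam)
        fun u hu => by
          rw [← hSre, End.mem_eigenspace_iff.1 hu, inner_smul_left, inner_self_eq_norm_sq_to_K]
          simp [← Complex.ofReal_pow]
      simp only [ht, Finset.sum_const, Finset.card_univ, nsmul_eq_mul] at hsum
      have hlam0 : 0 ≤ lam := by
        rw [hlam]
        refine Real.iSup_nonneg fun x => div_nonneg ?_ (by positivity)
        rw [hSre]
        positivity
      have : (D : ℝ) ≤ finrank ℂ (End.eigenspace S (lam : ℂ)) := by exact_mod_cast hED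
      nlinarith
  calc (∑ y, ‖inner ℂ (t y) v‖ ^ 2) * D ≤ lam * ‖v‖ ^ 2 * D := by
        gcongr
        exact hray v
    _ = lam * D * ‖v‖ ^ 2 := by ring
    _ ≤ _ := by gcongr

end LeftTranslation

section StepFunction

open Module

variable {G F : Type*} [Group G] [Fintype G] [Group F] [Fintype F] {N D : ℕ}

open Classical in
/-- The deviation of `f_Z` from its mean on the rectangle `{x | g x = i} × {y}`. -/
noncomputable def deviation (π : F →* G) (Z : Set G) (μ : ℝ) (g : G → Fin N) (i : Fin N)
    (y : F) : ℝ :=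
  ∑ x with g x = i, ((if (π y)⁻¹ * x ∈ Z then 1 else 0) - μ)

open Classical in
theorem sum_deviation_sq_mul_le (π : F →* G) (hπ : Function.Surjective π)
    (hD : ∀ (E : Submodule ℂ (EuclideanSpace ℂ G)) (ρ : Representation ℂ G E),
      finrank ℂ E < D → ∀ g, ρ g = 1)
    (Z : Set G) (g : G → Fin N) (i : Fin N) :
    (∑ y, deviation π Z (Z.ncard / Fintype.card G) g i y ^ 2) * D ≤
      Fintype.card F * Fintype.card G * ({x | g x = i} : Finset G).card := by
  set μ : ℝ := Z.ncard / Fintype.card G with hμ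
  have hG : (0 : ℝ) < Fintype.card G := by exact_mod_cast Fintype.card_pos
  have hcard : (∑ x : G, if x ∈ Z then (1 : ℝ) else 0) = Z.ncard := by
    rw [Finset.sum_boole, Set.ncard_eq_toFinset_card']
    congr 2
    ext x
    simp
  have hμ0 : 0 ≤ μ := by positivity
  have hμ1 : μ ≤ 1 := by
    rw [hμ, div_le_one hG]
    exact_mod_cast (Set.ncard_le_card Z).trans (Nat.card_eq_fintype_card).le
  let r : G → ℝ := fun x => (if x ∈ Z then 1 else 0) - μ
  let z : EuclideanSpace ℂ G := WithLp.toLp 2 fun x => (r x : ℂ)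
  have hz : ∑ x, z x = 0 := by
    change ∑ x, (r x : ℂ) = 0
    rw [← Complex.ofReal_sum, Complex.ofReal_eq_zero, Finset.sum_sub_distrib, hcard, hμ]
    simp only [Finset.sum_const, Finset.card_univ, nsmul_eq_mul]
    field_simp
    ring
  have hzn : ‖z‖ ^ 2 ≤ Fintype.card G := by
    rw [EuclideanSpace.norm_sq_eq]
    calc ∑ x, ‖z x‖ ^ 2 ≤ ∑ _x : G, (1 : ℝ) := by
          refine Finset.sum_le_sum fun x _ => ?_
          change ‖(r x : ℂ)‖ ^ 2 ≤ 1
          rw [Complex.norm_real, Real.norm_eq_abs, sq_abs, sq_le_one_iff_abs_le_one, abs_le]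
          simp only [r]
          split_ifs <;> constructor <;> linarith
      _ = _ := by simp
  let v : EuclideanSpace ℂ G := WithLp.toLp 2 fun x => if g x = i then 1 else 0
  have hv : ‖v‖ ^ 2 = ({x | g x = i} : Finset G).card := by
    rw [EuclideanSpace.norm_sq_eq, Finset.card_filter]
    push_cast
    refine Finset.sum_congr rfl fun x _ => ?_
    change ‖(if g x = i then 1 else 0 : ℂ)‖ ^ 2 = _
    split_ifs <;> simp
  have hin : ∀ y, inner ℂ (LeftTranslation.translate (π y) z) v =
      (deviation π Z μ g i y : ℂ) := by
    intro y
    rw [PiLp.inner_apply, deviation, Finset.sum_filter, Complex.ofReal_sum]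
    refine Finset.sum_congr rfl fun x _ => ?_
    rw [LeftTranslation.translate_apply, RCLike.inner_apply]
    change (if g x = i then 1 else 0 : ℂ) * (starRingEnd ℂ) (r ((π y)⁻¹ * x) : ℂ) = _
    rw [Complex.conj_ofReal]
    by_cases h : g x = i
    · simp [h, r]
    · simp [h]
  have key := LeftTranslation.sum_inner_sq_mul_le π hπ hD z hz v
  simp only [hin, Complex.norm_real, Real.norm_eq_abs, sq_abs, hv] at key
  exact key.trans (by gcongr)

theorem sum_abs_deviation_le (π : F →* G) (hπ : Function.Surjective π) (hN : 1 ≤ N)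
    (hND : 64 * N ≤ D)
    (hD : ∀ (E : Submodule ℂ (EuclideanSpace ℂ G)) (ρ : Representation ℂ G E),
      finrank ℂ E < D → ∀ g, ρ g = 1)
    (Z : Set G) (g : G → Fin N) :
    ∑ y, ∑ i, |deviation π Z (Z.ncard / Fintype.card G) g i y| ≤
      Fintype.card G * Fintype.card F / 8 := by
  have hsq : (∑ y, ∑ i, |deviation π Z (Z.ncard / Fintype.card G) g i y|) ^ 2 ≤
      Fintype.card F * N *
        ∑ i, ∑ y, deviation π Z (Z.ncard / Fintype.card G) g i y ^ 2 := by
    rw [← Finset.sum_product', Finset.sum_comm, ← Finset.sum_product']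
    refine sq_sum_le_card_mul_sum_sq.trans_eq ?_
    simp
  have hsum : (∑ i, ∑ y, deviation π Z (Z.ncard / Fintype.card G) g i y ^ 2) * D ≤
      Fintype.card F * Fintype.card G * Fintype.card G := by
    rw [Finset.sum_mul]
    refine (Finset.sum_le_sum fun i _ => sum_deviation_sq_mul_le π hπ hD Z g i).trans_eq ?_
    rw [← Finset.mul_sum]
    congr 1
    exact_mod_cast (Finset.card_eq_sum_card_fiberwise (s := Finset.univ) (t := Finset.univ)
      (f := g) fun _ _ => Finset.mem_coe.2 (Finset.mem_univ _)).symm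
  set e := ∑ y, ∑ i, |deviation π Z (Z.ncard / Fintype.card G) g i y|
  set q := ∑ i, ∑ y, deviation π Z (Z.ncard / Fintype.card G) g i y ^ 2
  have hq : 0 ≤ q := by positivity
  have hN' : (0 : ℝ) < N := by exact_mod_cast hN
  have hND' : (64 : ℝ) * N ≤ D := by exact_mod_cast hND
  have h64 : 64 * (N * q) ≤ Fintype.card F * Fintype.card G * Fintype.card G := by nlinarith
  refine abs_le_of_sq_le_sq' ?_ (by positivity) |>.2
  have hF : (0 : ℝ) ≤ Fintype.card F := by positivity
  nlinarith

open Classical in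
theorem ncard_step_ne_ge (π : F →* G) (hπ : Function.Surjective π) (hN : 1 ≤ N)
    (hND : 64 * N ≤ D)
    (hD : ∀ (E : Submodule ℂ (EuclideanSpace ℂ G)) (ρ : Representation ℂ G E),
      finrank ℂ E < D → ∀ g, ρ g = 1)
    (Z : Set G) (hZ₁ : (Fintype.card G : ℝ) / 4 ≤ Z.ncard)
    (hZ₂ : (Fintype.card G : ℝ) / 4 ≤ Fintype.card G - Z.ncard)
    (g : G → Fin N) (h : F → Fin N) (φ : Fin N × Fin N → Fin 2) :
    (Fintype.card G * Fintype.card F : ℝ) / 8 ≤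
      ({p | φ (g p.1, h p.2) ≠ if (π p.2)⁻¹ * p.1 ∈ Z then 1 else 0} : Set (G × F)).ncard := by
  set μ : ℝ := Z.ncard / Fintype.card G with hμ
  have hG : (0 : ℝ) < Fintype.card G := by exact_mod_cast Fintype.card_pos
  have hμ0 : 1 / 4 ≤ μ := by rw [hμ, le_div_iff₀ hG]; linarith
  have hμ1 : μ ≤ 3 / 4 := by rw [hμ, div_le_iff₀ hG]; linarith
  have hcell : ∀ y i, ∑ x with g x = i, (1 / 4 : ℝ) - |deviation π Z μ g i y| ≤
      ∑ x with g x = i,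
        if φ (g x, h y) ≠ (if (π y)⁻¹ * x ∈ Z then 1 else 0) then (1 : ℝ) else 0 := by
    intro y i
    rw [sub_le_iff_le_add]
    have h2 : φ (i, h y) = 0 ∨ φ (i, h y) = 1 := by omega
    rcases h2 with h0 | h1
    · refine le_trans ?_ (add_le_add_right (neg_le_abs _) _)
      rw [deviation, ← sub_eq_add_neg, ← Finset.sum_sub_distrib]
      refine Finset.sum_le_sum fun x hx => ?_
      rw [(Finset.mem_filter.1 hx).2, h0]
      split_ifs <;> simp_all
    · refine le_trans ?_ (add_le_add_right (le_abs_self _) _)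
      rw [deviation, ← Finset.sum_add_distrib]
      refine Finset.sum_le_sum fun x hx => ?_
      rw [(Finset.mem_filter.1 hx).2, h1]
      split_ifs <;> simp_all <;> linarith
  have hcount : (({p | φ (g p.1, h p.2) ≠ if (π p.2)⁻¹ * p.1 ∈ Z then 1 else 0} :
      Set (G × F)).ncard : ℝ) = ∑ y, ∑ i, ∑ x with g x = i,
        if φ (g x, h y) ≠ (if (π y)⁻¹ * x ∈ Z then 1 else 0) then (1 : ℝ) else 0 := by
    simp only [Finset.sum_fiberwise]
    rw [Set.ncard_eq_toFinset_card', Set.toFinset_ofPred, Finset.card_filter]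
    push_cast
    rw [← Finset.univ_product_univ, Finset.sum_product_right]
  have hmain : ∑ y : F, ∑ i, (∑ x with g x = i, (1 / 4 : ℝ) - |deviation π Z μ g i y|) =
      Fintype.card G * Fintype.card F / 4 - ∑ y, ∑ i, |deviation π Z μ g i y| := by
    simp only [Finset.sum_sub_distrib, Finset.sum_fiberwise]
    simp only [Finset.sum_const, Finset.card_univ, nsmul_eq_mul]
    ring
  have hdev := sum_abs_deviation_le π hπ hN hND hD Z g
  rw [hcount]
  refine le_trans ?_ (Finset.sum_le_sum fun y _ => Finset.sum_le_sum fun i _ => hcell y i)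
  rw [hmain]
  linarith

end StepFunction

theorem mul_le_minFac_of_eq_floor {n N : ℕ} (hn : 2 ≤ n)
    (hN : N = Nat.floor (Real.sqrt ((n.minFac : ℝ) - 1) / 25)) (hN1 : 1 ≤ N) :
    64 * N ≤ (n.minFac - 1) / 2 := by
  have hp : 2 ≤ n.minFac := (Nat.minFac_prime (by omega)).two_le
  have hp' : (2 : ℝ) ≤ n.minFac := by exact_mod_cast hp
  have h1 : (N : ℝ) ≤ Real.sqrt ((n.minFac : ℝ) - 1) / 25 := by
    rw [hN]
    exact Nat.floor_le (by positivity)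
  have h2 : (25 * N : ℝ) ^ 2 ≤ n.minFac - 1 := by
    rw [← Real.sq_sqrt (show (0 : ℝ) ≤ (n.minFac : ℝ) - 1 by linarith)]
    gcongr
    linarith
  have h3 : 625 * N ^ 2 + 1 ≤ n.minFac := by
    have : (625 * N ^ 2 + 1 : ℝ) ≤ n.minFac := by nlinarith
    exact_mod_cast this
  have h4 : N ≤ N ^ 2 := Nat.le_self_pow two_ne_zero N
  omega

/-- Claim 5.8: with `p` the smallest prime divisor of `n` and `N = ⌊√(p−1)/25⌋ ≥ 1`, every
`N`-step function `f : G_n × G_m → {0,1}` (i.e. `f(x,y) = φ(g x, h y)` for some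
`g : G_n → N`, `h : G_m → N`, `φ : N × N → {0,1}`) is far from every `f_Z` with
`min{|Z|, |G_n| − |Z|} ≥ |G_n|/4`, namely `dist(f, f_Z) ≥ 1/8`. -/
theorem step_function_far_from_invariant (d n m : ℕ) (hd : 2 ≤ d) (hn : 2 ≤ n)
    (hm : 2 ≤ m) (hdvd : n ∣ m) (N : ℕ)
    (hN : N = Nat.floor (Real.sqrt ((n.minFac : ℝ) - 1) / 25)) (hN1 : 1 ≤ N)
    (f : SLmod d n × SLmod d m → Fin 2)
    (hstep : ∃ (g : SLmod d n → Fin N) (h : SLmod d m → Fin N)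
        (φ : Fin N × Fin N → Fin 2), ∀ p, f p = φ (g p.1, h p.2))
    (Z : Set (SLmod d n))
    (hZ₁ : (Nat.card (SLmod d n) : ℝ) / 4 ≤ Z.ncard)
    (hZ₂ : (Nat.card (SLmod d n) : ℝ) / 4 ≤ Nat.card (SLmod d n) - Z.ncard) :
    1 / 8 ≤ distFn d n m f (fZ d hdvd Z) := by
  have : NeZero n := ⟨by omega⟩
  have : NeZero m := ⟨by omega⟩
  let _ := Fintype.ofFinite (SLmod d n)
  let _ := Fintype.ofFinite (SLmod d m)
  obtain ⟨g, h, φ, hf⟩ := hstep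
  simp only [Nat.card_eq_fintype_card] at hZ₁ hZ₂
  have hπ : Function.Surjective (redMod d hdvd) :=
    Matrix.SpecialLinearGroup.map_surjective_of_finite d (ZMod.castHom_surjective hdvd)
  have key := ncard_step_ne_ge (redMod d hdvd) hπ hN1 (mul_le_minFac_of_eq_floor hn hN hN1)
    (fun E ρ hE => Representation.eq_one_of_finrank_lt hn ρ hE) Z hZ₁ hZ₂ g h φ
  have hpos : (0 : ℝ) < Fintype.card (SLmod d n) * Fintype.card (SLmod d m) := by
    exact_mod_cast Nat.mul_pos Fintype.card_pos Fintype.card_pos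
  simp only [distFn, fZ, hf, Nat.card_eq_fintype_card]
  rw [le_div_iff₀ hpos]
  linarith
end
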